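/- There exists a universal constant α > 0 such that for every n ≥ 2 there is a matrix Tₙ ∈ Mₙ(ℂ) with ‖Tₙ‖ = 1 satisfying ‖PTₙ − TₙP‖₂ ≥ α for every projection P ∈ Mₙ(ℂ) of rank ⌊n/2⌋, where ‖·‖₂ is the normalized Hilbert–Schmidt norm. -/

import Mathlib

open scoped Matrix

/-- The normalized trace `τₙ = Tr/n` on `Mₙ(ℂ)`. -/
noncomputable def matTrace (n : ℕ) (X : Matrix (Fin n) (Fin n) ℂ) : ℂ :=
  X.trace / (n : ℂ)

/-- The normalized Hilbert–Schmidt norm `‖X‖₂ = (Tr(X*X)/n)^{1/2}` on `Mₙ(ℂ)`. -/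
noncomputable def matNorm2 (n : ℕ) (X : Matrix (Fin n) (Fin n) ℂ) : ℝ :=
  Real.sqrt ((matTrace n (Xᴴ * X)).re)

/-- The operator norm of a matrix, acting on `ℓ²(Fin n)`. -/
noncomputable def matOpNorm (n : ℕ) (X : Matrix (Fin n) (Fin n) ℂ) : ℝ :=
  ‖Matrix.toEuclideanCLM (𝕜 := ℂ) X‖

/-- A self-adjoint idempotent matrix. -/
def matIsProjection (n : ℕ) (P : Matrix (Fin n) (Fin n) ℂ) : Prop :=
  P.IsHermitian ∧ P * P = P

/-- Mass of a nearly `σ`-invariant density can be moved along `σ`, up to the mass outside `B`. -/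
theorem sum_sq_le_of_almost_invariant {α : Type*} [Fintype α] [DecidableEq α] (σ : Equiv.Perm α)
    (g : α → ℝ) (B E E' : Finset α) {η τ : ℝ} (hM : ∑ u, g u ^ 2 ≤ 1)
    (hη : ∑ u, (g (σ u) - g u) ^ 2 ≤ η) (hτ : ∑ u ∈ Bᶜ, g u ^ 2 ≤ τ)
    (hE : ∀ u ∈ E, u ∈ B → σ u ∈ E') :
    ∑ u ∈ E, g u ^ 2 ≤ τ + 1 / 40 + 41 * η + ∑ u ∈ E', g u ^ 2 := by
  have h1 : ∑ u ∈ E, g u ^ 2 ≤ ∑ u ∈ E ∩ B, g u ^ 2 + ∑ u ∈ Bᶜ, g u ^ 2 := by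
    rw [← Finset.sum_inter_add_sum_sdiff E B]
    gcongr
    intro u hu
    simp_all
  have h2 : ∑ u ∈ E ∩ B, g u ^ 2
      ≤ ∑ u ∈ E ∩ B, (g (σ u) ^ 2 + 1 / 40 * g (σ u) ^ 2 + 41 * (g (σ u) - g u) ^ 2) := by
    gcongr with u
    nlinarith [sq_nonneg (g (σ u) - 40 * (g u - g (σ u)))]
  have h3 : ∑ u ∈ E ∩ B, g (σ u) ^ 2 ≤ ∑ u ∈ E', g u ^ 2 := by
    have h := Finset.sum_map (E ∩ B) σ.toEmbedding (fun u => g u ^ 2)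
    simp only [Equiv.coe_toEmbedding] at h
    rw [← h]
    apply Finset.sum_le_sum_of_subset_of_nonneg
    · intro u hu
      simp only [Finset.mem_map, Finset.mem_inter] at hu
      obtain ⟨v, hv, rfl⟩ := hu
      exact hE v hv.1 hv.2
    · intros; positivity
  have h4 : ∑ u ∈ E ∩ B, g (σ u) ^ 2 ≤ 1 := by
    refine le_trans ?_ hM
    rw [← Equiv.sum_comp σ]
    exact Finset.sum_le_sum_of_subset_of_nonneg (Finset.subset_univ _) (by intros; positivity)
  have h5 : ∑ u ∈ E ∩ B, (g (σ u) - g u) ^ 2 ≤ η := le_trans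
    (Finset.sum_le_sum_of_subset_of_nonneg (Finset.subset_univ _) (by intros; positivity)) hη
  rw [Finset.sum_add_distrib, Finset.sum_add_distrib, ← Finset.mul_sum, ← Finset.mul_sum] at h2
  linarith

/-- The shear `(a, b) ↦ (a, b + a)`. -/
def zmodShear (n : ℕ) : Equiv.Perm (ZMod n × ZMod n) where
  toFun u := (u.1, u.2 + u.1)
  invFun u := (u.1, u.2 - u.1)
  left_inv u := by simp
  right_inv u := by simp

/-- The quarter turn `(a, b) ↦ (-b, a)`. -/
def zmodTurn (n : ℕ) : Equiv.Perm (ZMod n × ZMod n) where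
  toFun u := (-u.2, u.1)
  invFun u := (u.2, -u.1)
  left_inv u := by simp
  right_inv u := by simp

theorem ZMod.valMinAbs_add_of_small {n : ℕ} [NeZero n] {a b : ZMod n}
    (ha : 4 * |a.valMinAbs| < n) (hb : 4 * |b.valMinAbs| < n) :
    (a + b).valMinAbs = a.valMinAbs + b.valMinAbs := by
  rw [ZMod.valMinAbs_spec]
  refine ⟨by simp, ?_, ?_⟩
  · grind
  · grind

theorem ZMod.valMinAbs_neg_of_small {n : ℕ} [NeZero n] {a : ZMod n}
    (ha : 4 * |a.valMinAbs| < n) : (-a).valMinAbs = -a.valMinAbs := by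
  rw [ZMod.valMinAbs_spec]
  refine ⟨by simp, ?_, ?_⟩
  · grind
  · grind

theorem sum_sq_ne_zero_le {n : ℕ} [NeZero n] (g : ZMod n × ZMod n → ℝ) {η τ : ℝ}
    (hM : ∑ u, g u ^ 2 ≤ 1)
    (hS : ∑ u, (g (zmodShear n u) - g u) ^ 2 ≤ η)
    (hR : ∑ u, (g (zmodTurn n u) - g u) ^ 2 ≤ η)
    (hτ : ∑ u with ¬ (4 * |u.1.valMinAbs| < (n : ℤ) ∧ 4 * |u.2.valMinAbs| < (n : ℤ)), g u ^ 2 ≤ τ) :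
    ∑ u ∈ {0}ᶜ, g u ^ 2 ≤ 7 * (τ + 1 / 40 + 41 * η) := by
  set B : Finset (ZMod n × ZMod n) :=
    {u | 4 * |u.1.valMinAbs| < n ∧ 4 * |u.2.valMinAbs| < n} with hB
  set K : Finset (ZMod n × ZMod n) := {u | 0 < u.1.valMinAbs ∧ 0 ≤ u.2.valMinAbs ∨
    u.1.valMinAbs < 0 ∧ u.2.valMinAbs ≤ 0} with hK
  set K' : Finset (ZMod n × ZMod n) := {u | u.1.valMinAbs ≤ 0 ∧ 0 < u.2.valMinAbs ∨
    0 ≤ u.1.valMinAbs ∧ u.2.valMinAbs < 0} with hK'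
  set L : Finset (ZMod n × ZMod n) := {u ∈ K | |u.2.valMinAbs| < |u.1.valMinAbs|} with hL
  set L' : Finset (ZMod n × ZMod n) := {u ∈ K' | |u.2.valMinAbs| ≤ |u.1.valMinAbs|} with hL'
  have hLK : L ⊆ K := Finset.filter_subset _ _
  have hLK' : L' ⊆ K' := Finset.filter_subset _ _
  have hτ' : ∑ u ∈ Bᶜ, g u ^ 2 ≤ τ := by
    rwa [hB, Finset.compl_filter]
  have hS' : ∑ u, (g ((zmodShear n).symm u) - g u) ^ 2 ≤ η := by
    rw [← Equiv.sum_comp (zmodShear n)]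
    simp only [Equiv.symm_apply_apply]
    refine le_trans (le_of_eq (Finset.sum_congr rfl fun u _ => ?_)) hS
    ring
  have e1 := sum_sq_le_of_almost_invariant (zmodShear n) g B K (K \ L) hM hS hτ' (by
    rintro ⟨a, b⟩ h1 h2
    simp only [hB, hK, hL, Finset.mem_filter, Finset.mem_univ, true_and, zmodShear,
      Equiv.coe_fn_mk, Finset.mem_sdiff] at *
    rw [ZMod.valMinAbs_add_of_small h2.2 h2.1]
    grind)
  have e2 := sum_sq_le_of_almost_invariant (zmodShear n).symm g B K' (K' \ L') hM hS' hτ' (by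
    rintro ⟨a, b⟩ h1 h2
    simp only [hB, hK', hL', Finset.mem_filter, Finset.mem_univ, true_and, zmodShear,
      Equiv.coe_fn_symm_mk, Finset.mem_sdiff, sub_eq_add_neg] at *
    rw [ZMod.valMinAbs_add_of_small h2.2 (by rw [ZMod.valMinAbs_neg_of_small h2.1]; simpa using h2.1),
      ZMod.valMinAbs_neg_of_small h2.1]
    grind)
  have e3 := sum_sq_le_of_almost_invariant (zmodTurn n) g B (K \ L) L' hM hR hτ' (by
    rintro ⟨a, b⟩ h1 h2
    simp only [hB, hK, hL, hK', hL', Finset.mem_filter, Finset.mem_univ, true_and, zmodTurn,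
      Equiv.coe_fn_mk, Finset.mem_sdiff] at *
    rw [ZMod.valMinAbs_neg_of_small h2.2]
    grind)
  have e4 := sum_sq_le_of_almost_invariant (zmodTurn n) g B K' K hM hR hτ' (by
    rintro ⟨a, b⟩ h1 h2
    simp only [hB, hK, hK', Finset.mem_filter, Finset.mem_univ, true_and, zmodTurn,
      Equiv.coe_fn_mk] at *
    rw [ZMod.valMinAbs_neg_of_small h2.2]
    grind)
  have e5 : ∑ u ∈ {0}ᶜ, g u ^ 2 ≤ ∑ u ∈ K, g u ^ 2 + ∑ u ∈ K', g u ^ 2 := by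
    rw [← Finset.sum_union_inter]
    have : ({0}ᶜ : Finset (ZMod n × ZMod n)) ⊆ K ∪ K' := by
      rintro ⟨a, b⟩ h
      simp only [Finset.mem_compl, Finset.mem_singleton, Prod.mk_eq_zero,
        ← ZMod.valMinAbs_eq_zero] at h
      simp only [hK, hK', Finset.mem_union, Finset.mem_filter, Finset.mem_univ, true_and]
      grind
    have h1 := Finset.sum_le_sum_of_subset_of_nonneg this
      (f := fun u => g u ^ 2) (by intros; positivity)
    have h2 : 0 ≤ ∑ u ∈ K ∩ K', g u ^ 2 := by positivity
    linarith
  have s1 := Finset.sum_sdiff (f := fun u => g u ^ 2) hLK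
  have s2 := Finset.sum_sdiff (f := fun u => g u ^ 2) hLK'
  linarith

/-- The quadratic chirp `j ↦ exp (π i j (j + n) / n)` on `ℤ/n`. -/
noncomputable def zmodChirp (n : ℕ) (j : ZMod n) : ℂ :=
  Complex.exp (Real.pi * Complex.I * ((j.val : ℂ) * (j.val + n)) / n)

theorem zmodChirp_intCast (n : ℕ) [NeZero n] (k : ℤ) :
    zmodChirp n (k : ZMod n) = Complex.exp (Real.pi * Complex.I * ((k : ℂ) * (k + n)) / n) := by
  have hn : (n : ℂ) ≠ 0 := NeZero.ne _
  set q : ℤ := k / n with hq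
  have hv : (((k : ZMod n).val : ℤ) : ℂ) = k - n * q := by
    rw [ZMod.val_intCast, hq, Int.emod_def]
    push_cast
    ring
  rw [Int.cast_natCast] at hv
  obtain ⟨t, ht⟩ := Int.even_mul_pred_self q
  have ht' : (q : ℂ) * (q - 1) = t + t := by exact_mod_cast ht
  rw [zmodChirp, hv, Complex.exp_eq_exp_iff_exists_int]
  refine ⟨n * t - q * k, ?_⟩
  push_cast
  field_simp
  linear_combination (n : ℂ) ^ 2 * ht'

theorem zmodChirp_add (n : ℕ) [NeZero n] (j a : ZMod n) :
    zmodChirp n (j + a) = zmodChirp n j * zmodChirp n a * ZMod.stdAddChar (j * a) := by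
  have hn : (n : ℂ) ≠ 0 := NeZero.ne _
  obtain ⟨j, rfl⟩ := ZMod.intCast_surjective j
  obtain ⟨a, rfl⟩ := ZMod.intCast_surjective a
  rw [← Int.cast_add, ← Int.cast_mul, zmodChirp_intCast, zmodChirp_intCast, zmodChirp_intCast,
    ZMod.stdAddChar_coe, ← Complex.exp_add, ← Complex.exp_add]
  congr 1
  push_cast
  field_simp
  ring

theorem zmodChirp_neg (n : ℕ) [NeZero n] (j : ZMod n) : zmodChirp n (-j) = zmodChirp n j := by
  have hn : (n : ℂ) ≠ 0 := NeZero.ne _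
  obtain ⟨j, rfl⟩ := ZMod.intCast_surjective j
  rw [← Int.cast_neg, zmodChirp_intCast, zmodChirp_intCast, Complex.exp_eq_exp_iff_exists_int]
  refine ⟨-j, ?_⟩
  push_cast
  field_simp
  ring

@[simp]
theorem norm_zmodChirp (n : ℕ) (j : ZMod n) : ‖zmodChirp n j‖ = 1 := by
  rw [zmodChirp, show (Real.pi * Complex.I * ((j.val : ℂ) * (j.val + n)) / n) =
    ((Real.pi * ((j.val : ℝ) * (j.val + n)) / n : ℝ) : ℂ) * Complex.I by push_cast; ring]
  exact Complex.norm_exp_ofReal_mul_I _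

theorem zmodChirp_mul_star (n : ℕ) (j : ZMod n) : zmodChirp n j * star (zmodChirp n j) = 1 := by
  rw [RCLike.star_def, Complex.mul_conj', norm_zmodChirp]
  simp

theorem one_le_norm_stdAddChar_sub_one {n : ℕ} [NeZero n] {a : ZMod n}
    (ha : (n : ℤ) ≤ 4 * |a.valMinAbs|) : 1 ≤ ‖ZMod.stdAddChar a - (1 : ℂ)‖ := by
  have hn : (0 : ℝ) < n := Nat.cast_pos.2 (NeZero.pos n)
  have hm := a.valMinAbs_mem_Ioc
  set v := a.valMinAbs with hv
  have h1 : 2 * |v| ≤ (n : ℤ) := by grind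
  have h1' : 2 * |(v : ℝ)| ≤ n := by exact_mod_cast h1
  have h2' : (n : ℝ) ≤ 4 * |(v : ℝ)| := by exact_mod_cast ha
  have hre : (ZMod.stdAddChar a : ℂ).re ≤ 0 := by
    rw [← ZMod.coe_valMinAbs a, ← hv, ZMod.stdAddChar_coe,
      show (2 * Real.pi * Complex.I * (v : ℂ) / n) = ((2 * Real.pi * v / n : ℝ) : ℂ) * Complex.I by
        push_cast; ring, Complex.exp_ofReal_mul_I_re, ← Real.cos_abs, abs_div, abs_mul,
      abs_of_pos Real.two_pi_pos, abs_of_pos hn]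
    apply Real.cos_nonpos_of_pi_div_two_le_of_le
    · rw [le_div_iff₀ hn]
      nlinarith [Real.pi_pos]
    · rw [div_le_iff₀ hn]
      nlinarith [Real.pi_pos, mul_pos Real.pi_pos hn]
  have := (abs_le.1 (Complex.abs_re_le_norm (ZMod.stdAddChar a - (1 : ℂ)))).1
  simp only [Complex.sub_re, Complex.one_re] at this
  linarith

/-- The action on Weyl coefficients of conjugation by the shifted Fourier matrix. -/
noncomputable def turnOp {n : ℕ} [NeZero n] (f : ZMod n × ZMod n → ℂ) (u : ZMod n × ZMod n) : ℂ :=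
  ZMod.stdAddChar (-(u.1 * u.2) - u.2) * f (zmodTurn n u)

/-- The action on Weyl coefficients of conjugation by the chirp. -/
noncomputable def shearOp {n : ℕ} (f : ZMod n × ZMod n → ℂ) (u : ZMod n × ZMod n) : ℂ :=
  zmodChirp n u.1 * f (zmodShear n u)

theorem norm_shearOp {n : ℕ} (f : ZMod n × ZMod n → ℂ) (u : ZMod n × ZMod n) :
    ‖shearOp f u‖ = ‖f (zmodShear n u)‖ := by
  rw [shearOp, norm_mul, norm_zmodChirp, one_mul]

theorem shearOp_sub {n : ℕ} (f g : ZMod n × ZMod n → ℂ) : shearOp (f - g) = shearOp f - shearOp g := by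
  ext u; simp [shearOp, mul_sub]

theorem norm_add_sq_le_two {E : Type*} [SeminormedAddCommGroup E] (x y : E) :
    ‖x + y‖ ^ 2 ≤ 2 * ‖x‖ ^ 2 + 2 * ‖y‖ ^ 2 := by
  have := norm_add_le x y
  nlinarith [norm_nonneg (x + y), sq_nonneg (‖x‖ - ‖y‖)]

theorem norm_add_sq_le_three {E : Type*} [SeminormedAddCommGroup E] (x y z : E) :
    ‖x + y + z‖ ^ 2 ≤ 3 * ‖x‖ ^ 2 + 3 * ‖y‖ ^ 2 + 3 * ‖z‖ ^ 2 := by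
  have := norm_add₃_le (a := x) (b := y) (c := z)
  nlinarith [norm_nonneg (x + y + z), sq_nonneg (‖x‖ - ‖y‖), sq_nonneg (‖x‖ - ‖z‖),
    sq_nonneg (‖y‖ - ‖z‖)]

theorem sum_norm_sq_add_three_le {α : Type*} [Fintype α] (x y z : α → ℂ) :
    ∑ u, ‖(x + y + z) u‖ ^ 2 ≤ 3 * ∑ u, ‖x u‖ ^ 2 + 3 * ∑ u, ‖y u‖ ^ 2 + 3 * ∑ u, ‖z u‖ ^ 2 := by
  simp only [Finset.mul_sum, ← Finset.sum_add_distrib]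
  exact Finset.sum_le_sum fun u _ => norm_add_sq_le_three _ _ _

section
variable {n : ℕ} [NeZero n]

theorem norm_turnOp (f : ZMod n × ZMod n → ℂ) (u : ZMod n × ZMod n) :
    ‖turnOp f u‖ = ‖f (zmodTurn n u)‖ := by
  rw [turnOp, norm_mul, AddChar.norm_apply, one_mul]

theorem turnOp_sub (f g : ZMod n × ZMod n → ℂ) : turnOp (f - g) = turnOp f - turnOp g := by
  ext u; simp [turnOp, mul_sub]

theorem sum_norm_sq_turnOp (f : ZMod n × ZMod n → ℂ) :
    ∑ u, ‖turnOp f u‖ ^ 2 = ∑ u, ‖f u‖ ^ 2 := by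
  simp only [norm_turnOp]
  exact Equiv.sum_comp (zmodTurn n) (fun u => ‖f u‖ ^ 2)

theorem sum_norm_sq_shearOp (f : ZMod n × ZMod n → ℂ) :
    ∑ u, ‖shearOp f u‖ ^ 2 = ∑ u, ‖f u‖ ^ 2 := by
  simp only [norm_shearOp]
  exact Equiv.sum_comp (zmodShear n) (fun u => ‖f u‖ ^ 2)

theorem turnOp_turnOp_shearOp (f : ZMod n × ZMod n → ℂ) (u : ZMod n × ZMod n) :
    turnOp (turnOp (shearOp f)) u =
      ZMod.stdAddChar u.1 * shearOp (turnOp (turnOp f)) u := by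
  obtain ⟨a, b⟩ := u
  simp only [turnOp, shearOp, zmodTurn, zmodShear, Equiv.coe_fn_mk, zmodChirp_neg]
  have h : (ZMod.stdAddChar (-(a * b) - b) * ZMod.stdAddChar (-(-b * a) - a) : ℂ) =
      ZMod.stdAddChar a * (ZMod.stdAddChar (-(a * (b + a)) - (b + a)) *
        ZMod.stdAddChar (-(-(b + a) * a) - a)) := by
    simp only [← AddChar.map_add_eq_mul]
    congr 1
    ring
  rw [show -b + -a = -(b + a) by ring]
  linear_combination (zmodChirp n a * f (-a, -(b + a))) * h

/-- Almost invariance under the turn and the shear forces almost invariance under translation. -/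
theorem sum_norm_sq_stdAddChar_sub_one_le (f : ZMod n × ZMod n → ℂ) {η : ℝ}
    (hT : ∑ u, ‖(turnOp f - f) u‖ ^ 2 ≤ η) (hS : ∑ u, ‖(shearOp f - f) u‖ ^ 2 ≤ η) :
    ∑ u : ZMod n × ZMod n, ‖ZMod.stdAddChar u.1 - (1 : ℂ)‖ ^ 2 * ‖f u‖ ^ 2 ≤ 36 * η := by
  have h1 : ∑ u, ‖(turnOp (turnOp (shearOp f)) - f) u‖ ^ 2 ≤ 9 * η := by
    have h := sum_norm_sq_add_three_le (turnOp (turnOp (shearOp f - f))) (turnOp (turnOp f - f))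
      (turnOp f - f)
    rw [sum_norm_sq_turnOp, sum_norm_sq_turnOp, sum_norm_sq_turnOp] at h
    simp only [turnOp_sub, sub_add_sub_cancel] at h
    linarith
  have h2 : ∑ u, ‖(shearOp (turnOp (turnOp f)) - f) u‖ ^ 2 ≤ 9 * η := by
    have h := sum_norm_sq_add_three_le (shearOp (turnOp (turnOp f - f))) (shearOp (turnOp f - f))
      (shearOp f - f)
    rw [sum_norm_sq_shearOp, sum_norm_sq_turnOp, sum_norm_sq_shearOp] at h
    simp only [turnOp_sub, shearOp_sub, sub_add_sub_cancel] at h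
    linarith
  calc _ ≤ ∑ u, (2 * ‖(turnOp (turnOp (shearOp f)) - f) u‖ ^ 2 +
        2 * ‖(shearOp (turnOp (turnOp f)) - f) u‖ ^ 2) := by
        refine Finset.sum_le_sum fun u _ => ?_
        have h := norm_add_sq_le_two ((turnOp (turnOp (shearOp f)) - f) u)
          (-(ZMod.stdAddChar u.1 * (shearOp (turnOp (turnOp f)) - f) u))
        rw [norm_neg, norm_mul, AddChar.norm_apply, one_mul] at h
        refine le_trans (le_of_eq ?_) h
        rw [← mul_pow, ← norm_mul]
        congr 2
        simp only [Pi.sub_apply, turnOp_turnOp_shearOp]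
        ring
    _ ≤ 36 * η := by
        rw [Finset.sum_add_distrib, ← Finset.mul_sum, ← Finset.mul_sum]
        linarith

/-- Spectral gap: an almost invariant family of Weyl coefficients is concentrated at the origin. -/
theorem sum_norm_sq_ne_zero_le (f : ZMod n × ZMod n → ℂ) {η : ℝ} (hM : ∑ u, ‖f u‖ ^ 2 ≤ 1)
    (hT : ∑ u, ‖(turnOp f - f) u‖ ^ 2 ≤ η) (hS : ∑ u, ‖(shearOp f - f) u‖ ^ 2 ≤ η) :
    ∑ u ∈ {0}ᶜ, ‖f u‖ ^ 2 ≤ 7 * (1 / 40 + 151 * η) := by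
  have hR' : ∑ u, (‖f (zmodTurn n u)‖ - ‖f u‖) ^ 2 ≤ η := by
    refine le_trans (Finset.sum_le_sum fun u _ => ?_) hT
    rw [← norm_turnOp]
    exact sq_le_sq.2 (by rw [abs_norm]; exact abs_norm_sub_norm_le _ _)
  have hS' : ∑ u, (‖f (zmodShear n u)‖ - ‖f u‖) ^ 2 ≤ η := by
    refine le_trans (Finset.sum_le_sum fun u _ => ?_) hS
    rw [← norm_shearOp]
    exact sq_le_sq.2 (by rw [abs_norm]; exact abs_norm_sub_norm_le _ _)
  have hZ := sum_norm_sq_stdAddChar_sub_one_le f hT hS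
  have hZ' := hZ
  rw [← Equiv.sum_comp (zmodTurn n)] at hZ'
  have hτ : ∑ u : ZMod n × ZMod n with
      ¬ (4 * |u.1.valMinAbs| < (n : ℤ) ∧ 4 * |u.2.valMinAbs| < (n : ℤ)), ‖f u‖ ^ 2
        ≤ 110 * η := by
    calc _ ≤ ∑ u : ZMod n × ZMod n with
          ¬ (4 * |u.1.valMinAbs| < (n : ℤ) ∧ 4 * |u.2.valMinAbs| < (n : ℤ)),
          (‖ZMod.stdAddChar u.1 - (1 : ℂ)‖ ^ 2 * ‖f u‖ ^ 2 +
          2 * (‖ZMod.stdAddChar (zmodTurn n u).1 - (1 : ℂ)‖ ^ 2 * ‖f (zmodTurn n u)‖ ^ 2) +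
          2 * (‖f (zmodTurn n u)‖ - ‖f u‖) ^ 2) := by
          refine Finset.sum_le_sum fun u hu => ?_
          simp only [Finset.mem_filter, Finset.mem_univ, true_and] at hu
          by_cases ha : 4 * |u.1.valMinAbs| < (n : ℤ)
          · have hb : (n : ℤ) ≤ 4 * |u.2.valMinAbs| := by
              by_contra h
              exact hu ⟨ha, not_le.1 h⟩
            have h1 : 1 ≤ ‖ZMod.stdAddChar (zmodTurn n u).1 - (1 : ℂ)‖ := by
              apply one_le_norm_stdAddChar_sub_one
              simp only [zmodTurn, Equiv.coe_fn_mk]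
              have := ZMod.natAbs_valMinAbs_neg u.2
              grind
            have h2 := mul_le_mul_of_nonneg_right (one_le_pow₀ h1 (n := 2))
              (sq_nonneg ‖f (zmodTurn n u)‖)
            nlinarith [sq_nonneg (‖f u‖ - 2 * ‖f (zmodTurn n u)‖),
              mul_nonneg (sq_nonneg ‖ZMod.stdAddChar u.1 - (1 : ℂ)‖) (sq_nonneg ‖f u‖)]
          · have h1 := one_le_norm_stdAddChar_sub_one (not_lt.1 ha)
            have h2 := mul_le_mul_of_nonneg_right (one_le_pow₀ h1 (n := 2)) (sq_nonneg ‖f u‖)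
            have h3 : 0 ≤ 2 * (‖ZMod.stdAddChar (zmodTurn n u).1 - (1 : ℂ)‖ ^ 2 *
              ‖f (zmodTurn n u)‖ ^ 2) + 2 * (‖f (zmodTurn n u)‖ - ‖f u‖) ^ 2 := by positivity
            linarith
      _ ≤ ∑ u : ZMod n × ZMod n, (‖ZMod.stdAddChar u.1 - (1 : ℂ)‖ ^ 2 * ‖f u‖ ^ 2 +
          2 * (‖ZMod.stdAddChar (zmodTurn n u).1 - (1 : ℂ)‖ ^ 2 * ‖f (zmodTurn n u)‖ ^ 2) +
          2 * (‖f (zmodTurn n u)‖ - ‖f u‖) ^ 2) :=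
          Finset.sum_le_sum_of_subset_of_nonneg (Finset.subset_univ _) (by intros; positivity)
      _ ≤ 110 * η := by
          rw [Finset.sum_add_distrib, Finset.sum_add_distrib, ← Finset.mul_sum, ← Finset.mul_sum]
          linarith
  have h := sum_sq_ne_zero_le (fun u => ‖f u‖) hM hS' hR' hτ
  linarith

end

section
variable {ι : Type*} [Fintype ι]

/-- The square of the unnormalized Hilbert–Schmidt norm. -/
noncomputable def frobSq (M : Matrix ι ι ℂ) : ℝ := ∑ i, ∑ j, ‖M i j‖ ^ 2

theorem trace_conjTranspose_mul_self (M : Matrix ι ι ℂ) : (Mᴴ * M).trace = (frobSq M : ℂ) := by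
  simp only [Matrix.trace, Matrix.diag, Matrix.mul_apply, frobSq, Matrix.conjTranspose_apply]
  rw [Finset.sum_comm]
  push_cast
  refine Finset.sum_congr rfl fun i _ => Finset.sum_congr rfl fun j _ => ?_
  rw [RCLike.star_def, Complex.conj_mul']

theorem frobSq_nonneg (M : Matrix ι ι ℂ) : 0 ≤ frobSq M := by
  unfold frobSq; positivity

theorem frobSq_conjTranspose (M : Matrix ι ι ℂ) : frobSq Mᴴ = frobSq M := by
  simp only [frobSq, Matrix.conjTranspose_apply, norm_star]
  exact Finset.sum_comm

theorem frobSq_add_le (A B : Matrix ι ι ℂ) : frobSq (A + B) ≤ 2 * frobSq A + 2 * frobSq B := by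
  simp only [frobSq, Finset.mul_sum, ← Finset.sum_add_distrib]
  exact Finset.sum_le_sum fun i _ => Finset.sum_le_sum fun j _ => norm_add_sq_le_two _ _

theorem frobSq_neg (A : Matrix ι ι ℂ) : frobSq (-A) = frobSq A := by
  simp [frobSq]

theorem frobSq_sub_le (A B : Matrix ι ι ℂ) : frobSq (A - B) ≤ 2 * frobSq A + 2 * frobSq B := by
  rw [sub_eq_add_neg, ← frobSq_neg B]
  exact frobSq_add_le _ _

theorem frobSq_smul (c : ℝ) (A : Matrix ι ι ℂ) : frobSq (c • A) = c ^ 2 * frobSq A := by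
  simp [frobSq, Finset.mul_sum, mul_pow]

variable [DecidableEq ι]

theorem frobSq_unitary_mul {U : Matrix ι ι ℂ} (hU : Uᴴ * U = 1) (M : Matrix ι ι ℂ) :
    frobSq (U * M) = frobSq M := by
  have h : (((U * M)ᴴ * (U * M)).trace) = (Mᴴ * M).trace := by
    rw [Matrix.conjTranspose_mul, Matrix.mul_assoc, ← Matrix.mul_assoc Uᴴ, hU, Matrix.one_mul]
  rw [trace_conjTranspose_mul_self, trace_conjTranspose_mul_self] at h
  exact_mod_cast h

theorem frobSq_mul_unitary {U : Matrix ι ι ℂ} (hU : U * Uᴴ = 1) (M : Matrix ι ι ℂ) :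
    frobSq (M * U) = frobSq M := by
  rw [← frobSq_conjTranspose, Matrix.conjTranspose_mul, frobSq_unitary_mul, frobSq_conjTranspose]
  rwa [Matrix.conjTranspose_conjTranspose]

/-- A matrix almost commuting with `V G`, where `V` is unitary and `G` is a positive diagonal
matrix bounded above and below, almost commutes with `G`. -/
theorem frobSq_comm_diagonal_le {V P : Matrix ι ι ℂ} {g : ι → ℝ} (hV : Vᴴ * V = 1)
    (hP : P.IsHermitian) (h1 : ∀ i, 1 ≤ g i) (h3 : ∀ i, g i ≤ 3) :
    ∑ i, ∑ j, (g i - g j) ^ 2 * ‖P i j‖ ^ 2 ≤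
      9 * frobSq (P * (V * Matrix.diagonal fun i => (g i : ℂ)) -
        (V * Matrix.diagonal fun i => (g i : ℂ)) * P) := by
  set G : Matrix ι ι ℂ := Matrix.diagonal fun i => (g i : ℂ) with hG
  set C := P * (V * G) - (V * G) * P with hC
  have hV' : V * Vᴴ = 1 := mul_eq_one_comm.1 hV
  have hGH : Gᴴ = G := by
    rw [hG, Matrix.diagonal_conjTranspose]
    congr 1
    ext i
    simp
  have hGl : ∀ M : Matrix ι ι ℂ, frobSq (G * M) ≤ 9 * frobSq M := by
    intro M
    simp only [frobSq, Finset.mul_sum, hG, Matrix.diagonal_mul, norm_mul, mul_pow]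
    gcongr with i _ j
    rw [Complex.norm_real, Real.norm_eq_abs, sq_abs]
    nlinarith [h1 i, h3 i]
  have hGr : ∀ M : Matrix ι ι ℂ, frobSq (M * G) ≤ 9 * frobSq M := by
    intro M
    have := hGl Mᴴ
    rwa [← frobSq_conjTranspose, Matrix.conjTranspose_mul, Matrix.conjTranspose_conjTranspose, hGH,
      frobSq_conjTranspose] at this
  have hcomm : P * (G * G) - (G * G) * P = G * (Vᴴ * C) - Cᴴ * V * G := by
    have e1 : G * G = G * Vᴴ * (V * G) := by
      rw [Matrix.mul_assoc, ← Matrix.mul_assoc Vᴴ, hV, Matrix.one_mul]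
    have e2 : Cᴴ = G * Vᴴ * P - P * (G * Vᴴ) := by
      rw [hC]
      simp only [Matrix.conjTranspose_sub, Matrix.conjTranspose_mul, hGH, hP.eq, Matrix.mul_assoc]
    rw [e1, e2, hC]
    noncomm_ring
  have hC2 : frobSq (P * (G * G) - (G * G) * P) ≤ 36 * frobSq C := by
    rw [hcomm]
    refine (frobSq_sub_le _ _).trans ?_
    have a1 := hGl (Vᴴ * C)
    rw [frobSq_unitary_mul (U := Vᴴ) (by rwa [Matrix.conjTranspose_conjTranspose])] at a1
    have a2 := hGr (Cᴴ * V)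
    rw [frobSq_mul_unitary hV', frobSq_conjTranspose] at a2
    linarith
  have hC3 : 4 * ∑ i, ∑ j, (g i - g j) ^ 2 * ‖P i j‖ ^ 2
      ≤ frobSq (P * (G * G) - (G * G) * P) := by
    simp only [frobSq, Finset.mul_sum]
    gcongr with i _ j
    have : (P * (G * G) - (G * G) * P) i j = ((g j ^ 2 - g i ^ 2 : ℝ) : ℂ) * P i j := by
      simp only [hG, Matrix.diagonal_mul_diagonal, Matrix.sub_apply, Matrix.diagonal_mul,
        Matrix.mul_diagonal]
      push_cast
      ring
    rw [this, norm_mul, mul_pow, Complex.norm_real, Real.norm_eq_abs, sq_abs, ← mul_assoc]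
    gcongr
    have : 4 ≤ (g i + g j) ^ 2 := by nlinarith [h1 i, h1 j]
    nlinarith [sq_nonneg (g i - g j)]
  linarith

theorem frobSq_comm_unitary_le {V P : Matrix ι ι ℂ} {g : ι → ℝ} (hV : Vᴴ * V = 1)
    (hP : P.IsHermitian) (h1 : ∀ i, 1 ≤ g i) (h3 : ∀ i, g i ≤ 3) :
    frobSq (P * V - V * P) ≤
      20 * frobSq (P * (V * Matrix.diagonal fun i => (g i : ℂ)) -
        (V * Matrix.diagonal fun i => (g i : ℂ)) * P) := by
  have hD := frobSq_comm_diagonal_le hV hP h1 h3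
  set G : Matrix ι ι ℂ := Matrix.diagonal fun i => (g i : ℂ) with hG
  set C := P * (V * G) - (V * G) * P with hC
  have e : (P * V - V * P) * G = C - V * (P * G - G * P) := by
    rw [hC]; noncomm_ring
  have e1 : frobSq (P * V - V * P) ≤ frobSq ((P * V - V * P) * G) := by
    simp only [frobSq, hG, Matrix.mul_diagonal, norm_mul, mul_pow]
    gcongr with i _ j
    rw [Complex.norm_real, Real.norm_eq_abs, sq_abs]
    nlinarith [h1 j, sq_nonneg ‖(P * V - V * P) i j‖,
      mul_nonneg (sq_nonneg ‖(P * V - V * P) i j‖) (by nlinarith [h1 j] : 0 ≤ g j ^ 2 - 1)]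
  have e2 : frobSq (P * G - G * P) = ∑ i, ∑ j, (g i - g j) ^ 2 * ‖P i j‖ ^ 2 := by
    simp only [frobSq]
    refine Finset.sum_congr rfl fun i _ => Finset.sum_congr rfl fun j _ => ?_
    have : (P * G - G * P) i j = ((g j - g i : ℝ) : ℂ) * P i j := by
      simp only [hG, Matrix.sub_apply, Matrix.diagonal_mul, Matrix.mul_diagonal]
      push_cast
      ring
    rw [this, norm_mul, mul_pow, Complex.norm_real, Real.norm_eq_abs, sq_abs]
    ring
  have e3 := frobSq_sub_le C (V * (P * G - G * P))
  rw [frobSq_unitary_mul hV, ← e, e2] at e3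
  linarith

end

theorem norm_sub_le_abs_arg_sub {x y : ℂ} (hx : ‖x‖ = 1) (hy : ‖y‖ = 1) :
    ‖x - y‖ ≤ |x.arg - y.arg| := by
  have ex := Complex.norm_mul_exp_arg_mul_I x
  have ey := Complex.norm_mul_exp_arg_mul_I y
  rw [hx, Complex.ofReal_one, one_mul] at ex
  rw [hy, Complex.ofReal_one, one_mul] at ey
  have h := Real.norm_exp_I_mul_ofReal_sub_one_le (x := x.arg - y.arg)
  have e : x - y = y * (Complex.exp (Complex.I * ((x.arg - y.arg : ℝ) : ℂ)) - 1) := by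
    rw [mul_sub, mul_one]
    nth_rw 2 [← ey]
    rw [← Complex.exp_add]
    nth_rw 1 [← ex]
    congr 2
    push_cast
    ring
  rw [e, norm_mul, hy, one_mul]
  exact h

/-- The real weights `2 + arg (d j) / π ∈ [1, 3]` encoding the chirp `d`. -/
noncomputable def chirpWeight (n : ℕ) (j : ZMod n) : ℝ := 2 + (zmodChirp n j).arg / Real.pi

theorem one_le_chirpWeight {n : ℕ} (j : ZMod n) : 1 ≤ chirpWeight n j := by
  have h := (Complex.neg_pi_lt_arg (zmodChirp n j)).le
  have : -1 ≤ (zmodChirp n j).arg / Real.pi := by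
    rw [le_div_iff₀ Real.pi_pos]; linarith
  unfold chirpWeight
  linarith

theorem chirpWeight_le_three {n : ℕ} (j : ZMod n) : chirpWeight n j ≤ 3 := by
  have h := Complex.arg_le_pi (zmodChirp n j)
  have : (zmodChirp n j).arg / Real.pi ≤ 1 := by
    rw [div_le_iff₀ Real.pi_pos]; linarith
  unfold chirpWeight
  linarith

theorem norm_zmodChirp_sub_sq_le {n : ℕ} (i j : ZMod n) :
    ‖zmodChirp n i - zmodChirp n j‖ ^ 2 ≤ 10 * (chirpWeight n i - chirpWeight n j) ^ 2 := by
  have h := norm_sub_le_abs_arg_sub (norm_zmodChirp n i) (norm_zmodChirp n j)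
  have e : (zmodChirp n i).arg - (zmodChirp n j).arg =
      Real.pi * (chirpWeight n i - chirpWeight n j) := by
    unfold chirpWeight
    field_simp
    ring
  have h2 : ‖zmodChirp n i - zmodChirp n j‖ ^ 2 ≤
      Real.pi ^ 2 * (chirpWeight n i - chirpWeight n j) ^ 2 := by
    rw [← mul_pow, ← e, ← sq_abs (_ - _)]
    gcongr
  have hpi : Real.pi ^ 2 ≤ 10 := by nlinarith [Real.pi_lt_d2, Real.pi_pos]
  exact h2.trans (by gcongr)

theorem ofReal_sqrt_mul_self (n : ℕ) : ((Real.sqrt n : ℝ) : ℂ) * ((Real.sqrt n : ℝ) : ℂ) = n := by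
  rw [← Complex.ofReal_mul, Real.mul_self_sqrt (Nat.cast_nonneg n), Complex.ofReal_natCast]

section
variable {n : ℕ} [NeZero n]

/-- The normalized coefficients of a matrix in the basis of Weyl operators. -/
noncomputable def weylCoeff (M : Matrix (ZMod n) (ZMod n) ℂ) (u : ZMod n × ZMod n) : ℂ :=
  (∑ j, M (j + u.1) j * ZMod.stdAddChar (u.2 * j)) / n

theorem weylCoeff_sub (A B : Matrix (ZMod n) (ZMod n) ℂ) :
    weylCoeff (A - B) = weylCoeff A - weylCoeff B := by
  ext u
  simp [weylCoeff, sub_mul, sub_div, Finset.sum_sub_distrib]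

theorem weylCoeff_zero (M : Matrix (ZMod n) (ZMod n) ℂ) : weylCoeff M 0 = M.trace / n := by
  simp [weylCoeff, Matrix.trace]

theorem sum_stdAddChar_mul (b : ZMod n) :
    ∑ x : ZMod n, (ZMod.stdAddChar (x * b) : ℂ) = if b = 0 then (n : ℂ) else 0 := by
  rw [AddChar.sum_mulShift b (ZMod.isPrimitive_stdAddChar n), ZMod.card]
  split_ifs <;> simp

theorem conj_stdAddChar (x : ZMod n) :
    (starRingEnd ℂ) (ZMod.stdAddChar x) = ZMod.stdAddChar (-x) :=
  (AddChar.map_neg_eq_conj _ _).symm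

theorem sum_norm_sq_fourier (φ : ZMod n → ℂ) :
    ∑ b, ‖∑ j, φ j * ZMod.stdAddChar (b * j)‖ ^ 2 = n * ∑ j, ‖φ j‖ ^ 2 := by
  have h : ∑ b, (((‖∑ j, φ j * ZMod.stdAddChar (b * j)‖ ^ 2 : ℝ)) : ℂ)
      = n * ∑ j, ((‖φ j‖ ^ 2 : ℝ) : ℂ) := by
    calc _ = ∑ b, ∑ k, ∑ j, φ j * (starRingEnd ℂ) (φ k) *
          (ZMod.stdAddChar (b * (j - k)) : ℂ) := by
          refine Finset.sum_congr rfl fun b _ => ?_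
          rw [Complex.ofReal_pow, ← Complex.mul_conj', map_sum, Finset.mul_sum]
          refine Finset.sum_congr rfl fun k _ => ?_
          rw [Finset.sum_mul]
          refine Finset.sum_congr rfl fun j _ => ?_
          rw [map_mul (starRingEnd ℂ), conj_stdAddChar, mul_sub, sub_eq_add_neg,
            AddChar.map_add_eq_mul]
          ring
      _ = ∑ k, ∑ j, φ j * (starRingEnd ℂ) (φ k) * ∑ b, (ZMod.stdAddChar (b * (j - k)) : ℂ) := by
          rw [Finset.sum_comm]
          refine Finset.sum_congr rfl fun k _ => ?_
          rw [Finset.sum_comm]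
          simp only [Finset.mul_sum]
      _ = _ := by
          simp only [sum_stdAddChar_mul, sub_eq_zero, mul_ite, mul_zero, Finset.sum_ite_eq',
            Finset.mem_univ, if_true, Finset.mul_sum]
          refine Finset.sum_congr rfl fun k _ => ?_
          rw [Complex.mul_conj', mul_comm]
          push_cast
          ring
  exact_mod_cast h

theorem sum_norm_sq_weylCoeff (M : Matrix (ZMod n) (ZMod n) ℂ) :
    ∑ u, ‖weylCoeff M u‖ ^ 2 = frobSq M / n := by
  have hn : (n : ℝ) ≠ 0 := NeZero.ne _
  rw [Fintype.sum_prod_type]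
  simp only [weylCoeff, norm_div, div_pow, ← Finset.sum_div, Complex.norm_natCast]
  simp only [sum_norm_sq_fourier, ← Finset.mul_sum]
  have : ∑ a, ∑ j, ‖M (j + a) j‖ ^ 2 = frobSq M := by
    rw [frobSq, Finset.sum_comm]
    conv_rhs => rw [Finset.sum_comm]
    refine Finset.sum_congr rfl fun j _ => ?_
    exact Equiv.sum_comp (Equiv.addLeft j) (fun i => ‖M i j‖ ^ 2)
  rw [this]
  field_simp

/-- The Fourier matrix, composed with a translation. -/
noncomputable def shiftedFourier (n : ℕ) [NeZero n] : Matrix (ZMod n) (ZMod n) ℂ :=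
  Matrix.of fun j k => ZMod.stdAddChar (j * k + k) / ((Real.sqrt n : ℝ) : ℂ)

theorem star_shiftedFourier (j k : ZMod n) :
    star (shiftedFourier n j k) = ZMod.stdAddChar (-(j * k) - k) / ((Real.sqrt n : ℝ) : ℂ) := by
  rw [shiftedFourier, Matrix.of_apply, RCLike.star_def, map_div₀, Complex.conj_ofReal,
    conj_stdAddChar, neg_add']

theorem shiftedFourier_unitary : (shiftedFourier n)ᴴ * shiftedFourier n = 1 := by
  have hn : (n : ℂ) ≠ 0 := NeZero.ne _
  ext k l
  have h : ∀ j, (shiftedFourier n)ᴴ k j * shiftedFourier n j l =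
      ZMod.stdAddChar (l - k) / n * ZMod.stdAddChar (j * (l - k)) := by
    intro j
    rw [Matrix.conjTranspose_apply, star_shiftedFourier, shiftedFourier, Matrix.of_apply,
      div_mul_div_comm, ofReal_sqrt_mul_self, div_mul_eq_mul_div, ← AddChar.map_add_eq_mul,
      ← AddChar.map_add_eq_mul]
    congr 2
    ring
  simp only [Matrix.mul_apply, h, ← Finset.mul_sum, sum_stdAddChar_mul, sub_eq_zero,
    Matrix.one_apply, eq_comm (a := l)]
  split_ifs with hkl
  · subst hkl
    simp [hn]
  · simp

theorem weylCoeff_fourier_conj (M : Matrix (ZMod n) (ZMod n) ℂ) :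
    weylCoeff (shiftedFourier n * M * (shiftedFourier n)ᴴ) = turnOp (weylCoeff M) := by
  have hn : (n : ℂ) ≠ 0 := NeZero.ne _
  ext ⟨a, b⟩
  simp only [weylCoeff, turnOp, zmodTurn, Equiv.coe_fn_mk]
  rw [← mul_div_assoc]
  congr 1
  calc _ = ∑ j, ∑ l, ∑ k, M k l * ZMod.stdAddChar (a * k + k - l) / n *
        (ZMod.stdAddChar (j * (k - (l - b))) : ℂ) := by
        refine Finset.sum_congr rfl fun j _ => ?_
        rw [Matrix.mul_apply, Finset.sum_mul]
        refine Finset.sum_congr rfl fun l _ => ?_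
        rw [Matrix.mul_apply, Finset.sum_mul, Finset.sum_mul]
        refine Finset.sum_congr rfl fun k _ => ?_
        rw [Matrix.conjTranspose_apply, star_shiftedFourier, shiftedFourier, Matrix.of_apply]
        have h : (ZMod.stdAddChar ((j + a) * k + k) * ZMod.stdAddChar (-(j * l) - l) *
            ZMod.stdAddChar (b * j) : ℂ) =
            ZMod.stdAddChar (a * k + k - l) * ZMod.stdAddChar (j * (k - (l - b))) := by
          simp only [← AddChar.map_add_eq_mul]
          congr 1
          ring
        calc _ = M k l * (ZMod.stdAddChar ((j + a) * k + k) * ZMod.stdAddChar (-(j * l) - l) *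
            ZMod.stdAddChar (b * j)) / (((Real.sqrt n : ℝ) : ℂ) * ((Real.sqrt n : ℝ) : ℂ)) := by
              ring
          _ = _ := by rw [h, ofReal_sqrt_mul_self]; ring
    _ = ∑ l, ∑ k, M k l * ZMod.stdAddChar (a * k + k - l) / n *
        ∑ j, (ZMod.stdAddChar (j * (k - (l - b))) : ℂ) := by
        rw [Finset.sum_comm]
        refine Finset.sum_congr rfl fun l _ => ?_
        rw [Finset.sum_comm]
        simp only [Finset.mul_sum]
    _ = _ := by
        simp only [sum_stdAddChar_mul, sub_eq_zero (b := (_ - b)), mul_ite, mul_zero,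
          Finset.sum_ite_eq', Finset.mem_univ, if_true, Finset.mul_sum]
        refine Finset.sum_congr rfl fun l _ => ?_
        rw [div_mul_cancel₀ _ hn, mul_left_comm, ← AddChar.map_add_eq_mul, ← sub_eq_add_neg]
        congr 2
        ring

theorem weylCoeff_chirp_conj (M : Matrix (ZMod n) (ZMod n) ℂ) :
    weylCoeff (Matrix.of fun i j => zmodChirp n i * M i j * star (zmodChirp n j)) =
      shearOp (weylCoeff M) := by
  ext ⟨a, b⟩
  simp only [weylCoeff, shearOp, zmodShear, Equiv.coe_fn_mk, Matrix.of_apply]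
  rw [← mul_div_assoc, Finset.mul_sum]
  congr 1
  refine Finset.sum_congr rfl fun j _ => ?_
  have h := zmodChirp_mul_star n j
  rw [zmodChirp_add, add_mul, AddChar.map_add_eq_mul, mul_comm j a]
  linear_combination (zmodChirp n a * ZMod.stdAddChar (a * j) * M (j + a) j *
    ZMod.stdAddChar (b * j)) * h

/-- The shifted Fourier matrix times the positive diagonal matrix of chirp weights. -/
noncomputable def rigidMatrix (n : ℕ) [NeZero n] : Matrix (ZMod n) (ZMod n) ℂ :=
  shiftedFourier n * Matrix.diagonal fun j => (chirpWeight n j : ℂ)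

theorem rigidMatrix_ne_zero : rigidMatrix n ≠ 0 := by
  intro h
  have h1 : (shiftedFourier n)ᴴ * rigidMatrix n =
      Matrix.diagonal fun j => (chirpWeight n j : ℂ) := by
    rw [rigidMatrix, ← Matrix.mul_assoc, shiftedFourier_unitary, Matrix.one_mul]
  rw [h, Matrix.mul_zero] at h1
  have h2 := congrFun (congrFun h1 0) 0
  rw [Matrix.zero_apply, Matrix.diagonal_apply_eq] at h2
  have h3 := one_le_chirpWeight (0 : ZMod n)
  have h4 : chirpWeight n 0 = 0 := by exact_mod_cast h2.symm
  linarith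

open scoped Matrix.Norms.L2Operator in
theorem norm_rigidMatrix_le : ‖Matrix.toEuclideanCLM (𝕜 := ℂ) (rigidMatrix n)‖ ≤ 3 := by
  rw [← Matrix.cstar_norm_def, rigidMatrix, CStarRing.norm_mem_unitary_mul,
    Matrix.l2_opNorm_diagonal]
  · refine (pi_norm_le_iff_of_nonneg (by norm_num)).2 fun j => ?_
    rw [Complex.norm_real, Real.norm_eq_abs,
      abs_of_nonneg (zero_le_one.trans (one_le_chirpWeight j))]
    exact chirpWeight_le_three j
  · rw [Unitary.mem_iff]
    exact ⟨shiftedFourier_unitary, mul_eq_one_comm.1 shiftedFourier_unitary⟩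

theorem le_frobSq_comm_rigidMatrix (hn : 2 ≤ n) {P : Matrix (ZMod n) (ZMod n) ℂ}
    (hP : P.IsHermitian) (hPP : P * P = P) (htr : P.trace = ((n / 2 : ℕ) : ℂ)) :
    n / 10 ^ 7 ≤ frobSq (P * rigidMatrix n - rigidMatrix n * P) := by
  have hn0 : (0 : ℝ) < n := by positivity
  set c := frobSq (P * rigidMatrix n - rigidMatrix n * P) with hc
  set η : ℝ := 90 * c / n with hη
  have hc0 : 0 ≤ c := frobSq_nonneg _
  have hF : frobSq P = ((n / 2 : ℕ) : ℝ) := by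
    have := trace_conjTranspose_mul_self P
    rw [hP.eq, hPP, htr] at this
    exact_mod_cast this.symm
  have hT : ∑ u, ‖(turnOp (weylCoeff P) - weylCoeff P) u‖ ^ 2 ≤ η := by
    rw [← weylCoeff_fourier_conj, ← weylCoeff_sub, sum_norm_sq_weylCoeff, hη]
    gcongr
    have e : shiftedFourier n * P * (shiftedFourier n)ᴴ - P =
        -((P * shiftedFourier n - shiftedFourier n * P) * (shiftedFourier n)ᴴ) := by
      rw [sub_mul, Matrix.mul_assoc P, mul_eq_one_comm.1 (shiftedFourier_unitary (n := n)),
        Matrix.mul_one]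
      abel
    rw [e, frobSq_neg, frobSq_mul_unitary
      (by rw [Matrix.conjTranspose_conjTranspose]; exact shiftedFourier_unitary)]
    have := frobSq_comm_unitary_le shiftedFourier_unitary hP one_le_chirpWeight
      chirpWeight_le_three
    rw [← rigidMatrix, ← hc] at this
    linarith
  have hS : ∑ u, ‖(shearOp (weylCoeff P) - weylCoeff P) u‖ ^ 2 ≤ η := by
    rw [← weylCoeff_chirp_conj, ← weylCoeff_sub, sum_norm_sq_weylCoeff, hη]
    gcongr
    have := frobSq_comm_diagonal_le shiftedFourier_unitary hP one_le_chirpWeight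
      chirpWeight_le_three
    rw [← rigidMatrix, ← hc] at this
    refine le_trans ?_ (by linarith : 10 * ∑ i, ∑ j,
      (chirpWeight n i - chirpWeight n j) ^ 2 * ‖P i j‖ ^ 2 ≤ 90 * c)
    simp only [frobSq, Finset.mul_sum]
    gcongr with i _ j
    rw [← mul_assoc]
    refine le_trans (le_of_eq ?_) (mul_le_mul_of_nonneg_right (norm_zmodChirp_sub_sq_le i j)
      (sq_nonneg _))
    rw [← mul_pow, ← norm_mul, Matrix.sub_apply, Matrix.of_apply]
    have h := zmodChirp_mul_star n j
    have e : zmodChirp n i * P i j * star (zmodChirp n j) - P i j =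
        (zmodChirp n i - zmodChirp n j) * P i j * star (zmodChirp n j) := by
      linear_combination (P i j) * h
    rw [e, norm_mul _ (star _), norm_star, norm_zmodChirp, mul_one]
  set t : ℝ := ((n / 2 : ℕ) : ℝ) / n with ht
  have ht1 : t ≤ 1 / 2 := by
    rw [ht, div_le_iff₀ hn0]
    have : (2 * (n / 2 : ℕ) : ℝ) ≤ n := by exact_mod_cast Nat.mul_div_le n 2
    linarith
  have ht2 : 1 / 3 ≤ t := by
    rw [ht, le_div_iff₀ hn0]
    have : n ≤ 3 * (n / 2) := by omega
    have : (n : ℝ) ≤ 3 * (n / 2 : ℕ) := by exact_mod_cast this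
    linarith
  have hM : ∑ u, ‖weylCoeff P u‖ ^ 2 = t := by
    rw [sum_norm_sq_weylCoeff, hF]
  have h0 : ‖weylCoeff P 0‖ = t := by
    rw [weylCoeff_zero, htr, norm_div, Complex.norm_natCast, Complex.norm_natCast]
  have hgap := sum_norm_sq_ne_zero_le (weylCoeff P) (by linarith) hT hS
  have hsplit := Finset.sum_add_sum_compl {(0 : ZMod n × ZMod n)} (fun u => ‖weylCoeff P u‖ ^ 2)
  rw [Finset.sum_singleton, hM, h0] at hsplit
  have h1 : 4 / 10 ^ 5 ≤ η := by nlinarith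
  rw [hη, le_div_iff₀ hn0] at h1
  rw [div_le_iff₀ (by positivity)]
  linarith

end

theorem Matrix.trace_eq_rank_of_mul_self {ι : Type*} [Fintype ι] [DecidableEq ι]
    {P : Matrix ι ι ℂ} (hP : P * P = P) : P.trace = P.rank := by
  have h : IsIdempotentElem (Matrix.toLin' P) := by
    rw [IsIdempotentElem, Module.End.mul_eq_comp, ← Matrix.toLin'_mul, hP]
  rw [← Matrix.trace_toLin'_eq, ((LinearMap.isProj_range_iff_isIdempotentElem _).2 h).trace]
  rfl

/-- Lemma 4.2, Herrero–Szarek. There is a universal `α > 0` such that for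
every `n ≥ 2` some `Tₙ ∈ Mₙ(ℂ)` of operator norm one satisfies `‖PTₙ − TₙP‖₂ ≥ α` for
every projection `P` of rank `⌊n/2⌋`. -/
theorem stmt_9 :
    ∃ α : ℝ, 0 < α ∧ ∀ n : ℕ, 2 ≤ n →
      ∃ T : Matrix (Fin n) (Fin n) ℂ, matOpNorm n T = 1 ∧
        ∀ P : Matrix (Fin n) (Fin n) ℂ, matIsProjection n P → P.rank = n / 2 →
          α ≤ matNorm2 n (P * T - T * P) := by
  refine ⟨1 / 10 ^ 4, by norm_num, fun n hn => ?_⟩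
  obtain ⟨R, hR0, hR3, hR⟩ : ∃ R : Matrix (Fin n) (Fin n) ℂ, R ≠ 0 ∧ matOpNorm n R ≤ 3 ∧
      ∀ P : Matrix (Fin n) (Fin n) ℂ, P.IsHermitian → P * P = P → P.trace = ((n / 2 : ℕ) : ℂ) →
        n / 10 ^ 7 ≤ frobSq (P * R - R * P) := by
    obtain ⟨k, rfl⟩ : ∃ k, n = k + 1 := ⟨n - 1, by omega⟩
    refine ⟨rigidMatrix (k + 1), rigidMatrix_ne_zero, ?_, ?_⟩
    · have := norm_rigidMatrix_le (n := k + 1)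
      exact this
    · intro P h1 h2 h3
      exact le_frobSq_comm_rigidMatrix hn h1 h2 h3
  have hn0 : (0 : ℝ) < n := by positivity
  have hpos : 0 < matOpNorm n R := by
    rw [matOpNorm, norm_pos_iff]
    exact (map_ne_zero_iff _ (EquivLike.injective _)).2 hR0
  refine ⟨(matOpNorm n R)⁻¹ • R, ?_, fun P hP hr => ?_⟩
  · rw [matOpNorm, ← Complex.coe_smul, map_smul, norm_smul, Complex.norm_real, norm_inv,
      Real.norm_of_nonneg hpos.le]
    exact inv_mul_cancel₀ hpos.ne'
  · have h := hR P hP.1 hP.2 (by rw [Matrix.trace_eq_rank_of_mul_self hP.2, hr])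
    rw [matNorm2, matTrace, trace_conjTranspose_mul_self, Matrix.mul_smul, Matrix.smul_mul,
      ← smul_sub, frobSq_smul]
    apply Real.le_sqrt_of_sq_le
    rw [← Complex.ofReal_natCast, ← Complex.ofReal_div, Complex.ofReal_re, le_div_iff₀ hn0]
    have h9 : 1 / 9 ≤ (matOpNorm n R)⁻¹ ^ 2 := by
      rw [inv_pow, one_div]
      exact inv_anti₀ (by positivity) (by nlinarith)
    calc (1 / 10 ^ 4) ^ 2 * (n : ℝ) ≤ 1 / 9 * (n / 10 ^ 7) := by linarith
      _ ≤ _ := by gcongr
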